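/- Let s > 3/2 and s−1 ≤ s' ≤ s+1. There exists a constant C > 0, depending only on s and s', such that for all Schwartz vector fields u, j : ℝ³ → ℝ³ one has ∥(u·∇)j∥_{H^s} ≤ C ∥∇u∥_{H^{s'}} ∥∇j∥_{H^s}. -/

import Mathlib

open MeasureTheory SchwartzMap Real
open scoped FourierTransform

noncomputable section

/-- `ℝ³` as a Euclidean space. -/
abbrev E3 : Type := EuclideanSpace ℝ (Fin 3)

/-- The (squared-integral based) Sobolev `H^σ` norm of a complex-valued function on `ℝ³`,
defined via the Fourier transform. -/
noncomputable def HNorm (σ : ℝ) (f : E3 → ℂ) : ℝ :=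
  (∫ ξ : E3, (1 + ‖ξ‖ ^ 2) ^ σ * ‖𝓕 f ξ‖ ^ 2) ^ ((1 : ℝ) / 2)

/-- The Sobolev `H^σ` norm of a real-valued function. -/
noncomputable def HNormR (σ : ℝ) (f : E3 → ℝ) : ℝ :=
  HNorm σ (fun x => (f x : ℂ))

/-- The `j`-th partial derivative of a real-valued function on `ℝ³`. -/
noncomputable def pdR (j : Fin 3) (f : E3 → ℝ) : E3 → ℝ :=
  fun x => fderiv ℝ f x (EuclideanSpace.single j 1)

/-- The `j`-th partial derivative of a complex-valued function on `ℝ³`. -/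
noncomputable def pdC (j : Fin 3) (f : E3 → ℂ) : E3 → ℂ :=
  fun x => fderiv ℝ f x (EuclideanSpace.single j 1)

/-- The Sobolev `H^σ` norm of a vector field `u : ℝ³ → ℝ³`:
`∥u∥_{H^σ}² = Σ_i ∥u_i∥_{H^σ}²`. -/
noncomputable def VNorm (σ : ℝ) (u : Fin 3 → E3 → ℝ) : ℝ :=
  (∑ i : Fin 3, (HNormR σ (u i)) ^ 2) ^ ((1 : ℝ) / 2)

/-- `∥∇u∥_{H^σ}² = Σ_{i,j} ∥∂_j u_i∥_{H^σ}²` for a vector field `u : ℝ³ → ℝ³`. -/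
noncomputable def GradVNorm (σ : ℝ) (u : Fin 3 → E3 → ℝ) : ℝ :=
  (∑ i : Fin 3, ∑ j : Fin 3, (HNormR σ (pdR j (u i))) ^ 2) ^ ((1 : ℝ) / 2)

/-- The advection term `(u·∇)v`, with components `Σ_j u_j ∂_j v_i`. -/
noncomputable def adv (u v : Fin 3 → E3 → ℝ) : Fin 3 → E3 → ℝ :=
  fun i x => ∑ j : Fin 3, u j x * pdR j (v i) x

/-- The pointwise cross product of two vector fields on `ℝ³`. -/
noncomputable def crossVF (u v : Fin 3 → E3 → ℝ) : Fin 3 → E3 → ℝ :=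
  fun i x =>
    ![u 1 x * v 2 x - u 2 x * v 1 x,
      u 2 x * v 0 x - u 0 x * v 2 x,
      u 0 x * v 1 x - u 1 x * v 0 x] i

/-- A Schwartz vector field, viewed as a plain vector field. -/
noncomputable def toVF (u : Fin 3 → SchwartzMap E3 ℝ) : Fin 3 → E3 → ℝ :=
  fun i => ⇑(u i)

open scoped LineDeriv

/-- The Bessel weight `(1 + ‖ξ‖²)^(σ/2)`, valued in `ℝ≥0∞`. -/
def besselWeight (σ : ℝ) (ξ : E3) : ENNReal := ENNReal.ofReal ((1 + ‖ξ‖ ^ 2) ^ (σ / 2))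

/-- The squared Sobolev norm as a lower Lebesgue integral. -/
def sobolevSq (σ : ℝ) (f : E3 → ℂ) : ENNReal := ∫⁻ ξ, (besselWeight σ ξ * ‖𝓕 f ξ‖ₑ) ^ 2

lemma measurable_besselWeight (σ : ℝ) : Measurable (besselWeight σ) := by
  unfold besselWeight; fun_prop

lemma besselWeight_ne_zero (σ : ℝ) (ξ : E3) : besselWeight σ ξ ≠ 0 := by
  simp only [besselWeight, ne_eq, ENNReal.ofReal_eq_zero, not_le]
  positivity

lemma besselWeight_ne_top (σ : ℝ) (ξ : E3) : besselWeight σ ξ ≠ ⊤ := ENNReal.ofReal_ne_top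

lemma ENNReal.rpow_half_sq (a : ENNReal) : (a ^ (1 / 2 : ℝ)) ^ 2 = a := by
  rw [← ENNReal.rpow_natCast, ← ENNReal.rpow_mul]; norm_num

/-- Cauchy–Schwarz for lower Lebesgue integrals. -/
lemma lintegral_mul_sq_le {α : Type*} [MeasurableSpace α] {μ : Measure α} {f g : α → ENNReal}
    (hf : AEMeasurable f μ) (hg : AEMeasurable g μ) :
    (∫⁻ x, f x * g x ∂μ) ^ 2 ≤ (∫⁻ x, f x ^ 2 ∂μ) * ∫⁻ x, g x ^ 2 ∂μ := by
  have h := ENNReal.lintegral_mul_le_Lp_mul_Lq μ Real.HolderConjugate.two_two hf hg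
  simp only [Pi.mul_apply, ENNReal.rpow_two] at h
  calc _ ≤ _ := pow_le_pow_left' h 2
    _ = _ := by rw [mul_pow, ENNReal.rpow_half_sq, ENNReal.rpow_half_sq]

lemma ENNReal.sq_sum_le_card_mul_sum_sq {ι : Type*} [Fintype ι] (f : ι → ENNReal) :
    (∑ i, f i) ^ 2 ≤ Fintype.card ι * ∑ i, f i ^ 2 := by
  let _ : MeasurableSpace ι := ⊤
  have := lintegral_mul_sq_le (μ := Measure.count) (f := f) (g := fun _ => 1)
    measurable_from_top.aemeasurable (by fun_prop)
  simpa [lintegral_count, mul_comm] using this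

/-- Young's inequality `L¹ * L² → L²` for nonnegative functions. -/
lemma lintegral_conv_sq_le {F H : E3 → ENNReal} (hF : Measurable F) (hH : Measurable H) :
    ∫⁻ ξ, (∫⁻ t, F t * H (ξ - t)) ^ 2 ≤ (∫⁻ t, F t) ^ 2 * ∫⁻ t, H t ^ 2 := by
  have key (ξ : E3) : (∫⁻ t, F t * H (ξ - t)) ^ 2 ≤
      (∫⁻ t, F t) * ∫⁻ t, F t * H (ξ - t) ^ 2 := by
    have := lintegral_mul_sq_le (μ := (volume : Measure E3)) (f := fun t => F t ^ (1 / 2 : ℝ))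
      (g := fun t => F t ^ (1 / 2 : ℝ) * H (ξ - t)) (by fun_prop) (by fun_prop)
    simp only [← mul_assoc, mul_pow, ← pow_two, ENNReal.rpow_half_sq] at this
    exact this
  calc _ ≤ ∫⁻ ξ, (∫⁻ t, F t) * ∫⁻ t, F t * H (ξ - t) ^ 2 := lintegral_mono key
    _ = (∫⁻ t, F t) * ∫⁻ t, ∫⁻ ξ, F t * H (ξ - t) ^ 2 := by
      rw [lintegral_const_mul _ (by fun_prop), lintegral_lintegral_swap (by fun_prop)]
    _ = (∫⁻ t, F t) * ∫⁻ t, F t * ∫⁻ ξ, H ξ ^ 2 := by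
      congr 2 with t
      rw [lintegral_const_mul _ (by fun_prop), lintegral_sub_right_eq_self (fun ξ => H ξ ^ 2) t]
    _ = _ := by rw [lintegral_mul_const _ hF]; ring

/-- The two-weight Peetre-type inequality behind the product estimate. -/
lemma one_add_norm_add_sq_rpow_le {s s' : ℝ} (hs : 1 ≤ s) (hs' : s - 1 ≤ s') (x y : E3) :
    (1 + ‖x + y‖ ^ 2) ^ (s / 2) ≤
      4 ^ (s / 2) * ((1 + ‖x‖ ^ 2) ^ (s / 2) + ‖y‖ * (1 + ‖y‖ ^ 2) ^ (s' / 2)) := by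
  have h1 : 1 + ‖x + y‖ ^ 2 ≤ 1 + 2 * ‖x‖ ^ 2 + 2 * ‖y‖ ^ 2 := by
    nlinarith [norm_add_le x y, norm_nonneg (x + y), sq_nonneg (‖x‖ - ‖y‖)]
  have hx : 0 ≤ (1 + ‖x‖ ^ 2) ^ (s / 2) := by positivity
  have hy : 0 ≤ ‖y‖ * (1 + ‖y‖ ^ 2) ^ (s' / 2) := by positivity
  rcases le_total (‖y‖ ^ 2) (1 + ‖x‖ ^ 2) with h | h
  · calc (1 + ‖x + y‖ ^ 2) ^ (s / 2) ≤ (4 * (1 + ‖x‖ ^ 2)) ^ (s / 2) := by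
          gcongr; linarith
      _ = 4 ^ (s / 2) * (1 + ‖x‖ ^ 2) ^ (s / 2) := by
          rw [Real.mul_rpow (by norm_num) (by positivity)]
      _ ≤ _ := by gcongr; linarith
  · have hy1 : 1 ≤ ‖y‖ ^ 2 := by nlinarith [sq_nonneg ‖x‖]
    have hy0 : 0 < ‖y‖ ^ 2 := by linarith
    calc (1 + ‖x + y‖ ^ 2) ^ (s / 2) ≤ (4 * ‖y‖ ^ 2) ^ (s / 2) := by
          gcongr; linarith
      _ = 4 ^ (s / 2) * (‖y‖ * (‖y‖ ^ 2) ^ ((s - 1) / 2)) := by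
          rw [Real.mul_rpow (by norm_num) (by positivity),
            show s / 2 = 1 / 2 + (s - 1) / 2 by ring, Real.rpow_add hy0, ← Real.sqrt_eq_rpow,
            Real.sqrt_sq (norm_nonneg y)]
      _ ≤ 4 ^ (s / 2) * (‖y‖ * (1 + ‖y‖ ^ 2) ^ (s' / 2)) := by
          gcongr
          calc (‖y‖ ^ 2) ^ ((s - 1) / 2) ≤ (1 + ‖y‖ ^ 2) ^ ((s - 1) / 2) := by
                gcongr
                all_goals linarith
            _ ≤ _ := by
                gcongr
                linarith
      _ ≤ _ := by gcongr; linarith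

lemma besselWeight_le {s s' : ℝ} (hs : 1 ≤ s) (hs' : s - 1 ≤ s') (ξ t : E3) :
    besselWeight s ξ ≤ ENNReal.ofReal (4 ^ (s / 2)) *
      (besselWeight s (ξ - t) + ‖t‖ₑ * besselWeight s' t) := by
  have h := one_add_norm_add_sq_rpow_le hs hs' (ξ - t) t
  rw [sub_add_cancel] at h
  rw [← ofReal_norm]
  unfold besselWeight
  rw [← ENNReal.ofReal_mul (by positivity), ← ENNReal.ofReal_add (by positivity) (by positivity),
    ← ENNReal.ofReal_mul (by positivity)]
  exact ENNReal.ofReal_le_ofReal h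

lemma inv_besselWeight_sq (σ : ℝ) (ξ : E3) :
    (besselWeight σ ξ)⁻¹ ^ 2 = ENNReal.ofReal ((1 + ‖ξ‖ ^ 2) ^ (-σ)) := by
  unfold besselWeight
  rw [← ENNReal.ofReal_inv_of_pos (by positivity), ← ENNReal.ofReal_pow (by positivity),
    ← Real.rpow_neg (by positivity), ← Real.rpow_natCast, ← Real.rpow_mul (by positivity)]
  congr 2; push_cast; ring

lemma lintegral_inv_besselWeight_sq_lt_top {s : ℝ} (hs : 3 / 2 < s) :
    ∫⁻ ξ : E3, (besselWeight s ξ)⁻¹ ^ 2 < ⊤ := by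
  have h := integrable_rpow_neg_one_add_norm_sq (E := E3) (μ := volume) (r := 2 * s)
    (by simp; linarith)
  simp only [inv_besselWeight_sq]
  convert h.lintegral_lt_top using 4
  ring_nf

lemma lintegral_inv_norm_mul_besselWeight_sq_lt_top {s : ℝ} (hs : 1 / 2 < s) :
    ∫⁻ ξ : E3, (‖ξ‖ₑ * besselWeight s ξ)⁻¹ ^ 2 < ⊤ := by
  have h1 := integrable_rpow_neg_one_add_norm_sq (E := ℝ) (μ := volume) (r := 2 * s)
    (by simp; linarith)
  have h : Integrable (fun ξ : E3 => (fun r : ℝ => (r ^ 2)⁻¹ * (1 + r ^ 2) ^ (-s)) ‖ξ‖) := by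
    rw [integrable_fun_norm_addHaar volume
      (f := fun r : ℝ => (r ^ 2)⁻¹ * (1 + r ^ 2) ^ (-s))]
    refine (h1.integrableOn (s := Set.Ioi 0)).congr_fun (fun r hr => ?_) measurableSet_Ioi
    have hr : r ≠ 0 := (Set.mem_Ioi.1 hr).ne'
    simp only [finrank_euclideanSpace, Fintype.card_fin, smul_eq_mul, Real.norm_eq_abs, sq_abs]
    rw [← mul_assoc, Nat.add_one_sub_one, mul_inv_cancel₀ (by positivity), one_mul]
    congr 1; ring
  refine lt_of_eq_of_lt (lintegral_congr_ae ?_) h.lintegral_lt_top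
  filter_upwards [Measure.ae_ne volume (0 : E3)] with ξ hξ
  rw [ENNReal.mul_inv (.inl (by simpa)) (.inl (by simp)), mul_pow, inv_besselWeight_sq,
    ENNReal.ofReal_mul (by positivity), ENNReal.ofReal_inv_of_pos (by positivity),
    ENNReal.ofReal_pow (by positivity), ofReal_norm, ENNReal.inv_pow]

lemma lintegral_sq_le_of_weight {w F : E3 → ENNReal} (hw : Measurable w) (hF : Measurable F)
    (h0 : ∀ᵐ t, w t ≠ 0) (htop : ∀ᵐ t, w t ≠ ⊤) :
    (∫⁻ t, F t) ^ 2 ≤ (∫⁻ t, (w t)⁻¹ ^ 2) * ∫⁻ t, (w t * F t) ^ 2 := by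
  refine le_trans (le_of_eq ?_) (lintegral_mul_sq_le (by fun_prop) (by fun_prop))
  congr 1
  refine lintegral_congr_ae ?_
  filter_upwards [h0, htop] with t h0 htop
  rw [← mul_assoc, ENNReal.inv_mul_cancel h0 htop, one_mul]

/-- The product estimate on the Fourier side. -/
lemma exists_lintegral_besselWeight_conv_le {s s' : ℝ} (hs : 3 / 2 < s) (hs' : s - 1 ≤ s') :
    ∃ K : ENNReal, K ≠ ⊤ ∧ ∀ F H : E3 → ENNReal, Measurable F → Measurable H →
      ∫⁻ ξ, (besselWeight s ξ * ∫⁻ t, F t * H (ξ - t)) ^ 2 ≤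
        K * (∫⁻ t, (‖t‖ₑ * besselWeight s' t * F t) ^ 2) * ∫⁻ t, (besselWeight s t * H t) ^ 2 := by
  set K₁ := ∫⁻ ξ : E3, (‖ξ‖ₑ * besselWeight s' ξ)⁻¹ ^ 2
  set K₂ := ∫⁻ ξ : E3, (besselWeight s ξ)⁻¹ ^ 2
  set c := ENNReal.ofReal (4 ^ (s / 2))
  have hK₁ : K₁ ≠ ⊤ := (lintegral_inv_norm_mul_besselWeight_sq_lt_top (by linarith)).ne
  have hK₂ : K₂ ≠ ⊤ := (lintegral_inv_besselWeight_sq_lt_top hs).ne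
  have hc : c ≠ ⊤ := ENNReal.ofReal_ne_top
  have m := measurable_besselWeight
  refine ⟨c ^ 2 * 2 * (K₁ + K₂), by finiteness, fun F H hF hH => ?_⟩
  set F' : E3 → ENNReal := fun t => ‖t‖ₑ * besselWeight s' t * F t
  set H' : E3 → ENNReal := fun t => besselWeight s t * H t
  have hF' : Measurable F' := by have := m s'; fun_prop
  have hH' : Measurable H' := by have := m s; fun_prop
  have hpt (ξ : E3) : (besselWeight s ξ * ∫⁻ t, F t * H (ξ - t)) ^ 2 ≤
      c ^ 2 * 2 * ((∫⁻ t, F t * H' (ξ - t)) ^ 2 + (∫⁻ t, F' t * H (ξ - t)) ^ 2) := by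
    have : besselWeight s ξ * ∫⁻ t, F t * H (ξ - t) ≤
        c * ((∫⁻ t, F t * H' (ξ - t)) + ∫⁻ t, F' t * H (ξ - t)) := by
      rw [← lintegral_const_mul _ (by fun_prop), ← lintegral_add_left (by fun_prop),
        ← lintegral_const_mul _ (by fun_prop)]
      refine lintegral_mono fun t => ?_
      calc _ ≤ c * (besselWeight s (ξ - t) + ‖t‖ₑ * besselWeight s' t) * (F t * H (ξ - t)) := by
            gcongr; exact besselWeight_le (by linarith) hs' ξ t
        _ = _ := by simp only [F', H']; ring
    calc _ ≤ (c * ((∫⁻ t, F t * H' (ξ - t)) + ∫⁻ t, F' t * H (ξ - t))) ^ 2 := by gcongr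
      _ ≤ _ := by
        rw [mul_pow, mul_assoc]
        gcongr
        simpa using ENNReal.sq_sum_le_card_mul_sum_sq ![∫⁻ t, F t * H' (ξ - t), ∫⁻ t, F' t * H (ξ - t)]
  have hF1 : (∫⁻ t, F t) ^ 2 ≤ K₁ * ∫⁻ t, F' t ^ 2 :=
    lintegral_sq_le_of_weight (w := fun t => ‖t‖ₑ * besselWeight s' t)
      (by have := m s'; fun_prop) hF
      (by filter_upwards [Measure.ae_ne volume (0 : E3)] with t ht
          simp [ht, besselWeight_ne_zero])
      (.of_forall fun t => ENNReal.mul_ne_top (by simp) (besselWeight_ne_top _ _))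
  have hH1 : (∫⁻ t, H t) ^ 2 ≤ K₂ * ∫⁻ t, H' t ^ 2 :=
    lintegral_sq_le_of_weight (m s) hH (.of_forall (besselWeight_ne_zero s))
      (.of_forall (besselWeight_ne_top s))
  have hY1 := lintegral_conv_sq_le hF hH'
  have hY2 : ∫⁻ ξ, (∫⁻ t, F' t * H (ξ - t)) ^ 2 ≤ (∫⁻ t, H t) ^ 2 * ∫⁻ t, F' t ^ 2 := by
    refine le_trans (le_of_eq ?_) (lintegral_conv_sq_le hH hF')
    congr 1 with ξ
    rw [← lintegral_sub_left_eq_self _ ξ]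
    simp [mul_comm]
  calc _ ≤ ∫⁻ ξ, c ^ 2 * 2 *
          ((∫⁻ t, F t * H' (ξ - t)) ^ 2 + (∫⁻ t, F' t * H (ξ - t)) ^ 2) := lintegral_mono hpt
    _ = c ^ 2 * 2 * ((∫⁻ ξ, (∫⁻ t, F t * H' (ξ - t)) ^ 2) +
          ∫⁻ ξ, (∫⁻ t, F' t * H (ξ - t)) ^ 2) := by
      rw [lintegral_const_mul _ (by fun_prop), lintegral_add_left (by fun_prop)]
    _ ≤ c ^ 2 * 2 * (K₁ * (∫⁻ t, F' t ^ 2) * (∫⁻ t, H' t ^ 2) +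
          K₂ * (∫⁻ t, H' t ^ 2) * ∫⁻ t, F' t ^ 2) := by
      gcongr
      · exact hY1.trans (by gcongr)
      · exact hY2.trans (by gcongr)
    _ = _ := by ring

lemma fourier_pairing_mul_apply (f g : 𝓢(E3, ℂ)) (ξ : E3) :
    𝓕 (pairing (ContinuousLinearMap.mul ℂ ℂ) f g) ξ = ∫ t, 𝓕 f t * 𝓕 g (ξ - t) := by
  have h : 𝓕⁻ (SchwartzMap.convolution (ContinuousLinearMap.mul ℂ ℂ) (𝓕 f) (𝓕 g)) =
      pairing (ContinuousLinearMap.mul ℂ ℂ) f g := by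
    ext x
    rw [pairing_apply_apply, fourierInv_coe, Real.fourierInv_eq_fourier_neg, ← fourier_coe,
      fourier_convolution, pairing_apply_apply]
    have hinv (f : 𝓢(E3, ℂ)) : 𝓕 (𝓕 f) (-x) = f x := by
      rw [fourier_coe, ← Real.fourierInv_eq_fourier_neg, ← fourierInv_coe,
        FourierTransform.fourierInv_fourier_eq]
    rw [hinv, hinv]
  rw [← h, FourierTransform.fourier_fourierInv_eq, SchwartzMap.convolution_apply]
  rfl

lemma enorm_fourier_pairing_mul_le (f g : 𝓢(E3, ℂ)) (ξ : E3) :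
    ‖𝓕 (pairing (ContinuousLinearMap.mul ℂ ℂ) f g) ξ‖ₑ ≤ ∫⁻ t, ‖𝓕 f t‖ₑ * ‖𝓕 g (ξ - t)‖ₑ := by
  rw [fourier_pairing_mul_apply]
  simpa [enorm_mul] using enorm_integral_le_lintegral_enorm (fun t => 𝓕 f t * 𝓕 g (ξ - t))

lemma integrable_rpow_mul_norm_fourier_sq (σ : ℝ) (f : 𝓢(E3, ℂ)) :
    Integrable fun ξ : E3 => (1 + ‖ξ‖ ^ 2) ^ σ * ‖𝓕 f ξ‖ ^ 2 := by
  have h := (pairing (ContinuousLinearMap.mul ℂ ℂ)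
    (smulLeftCLM ℂ (fun ξ : E3 => (1 + ‖ξ‖ ^ 2) ^ σ) (𝓕 f)) (𝓕 f)).integrable (μ := volume)
  refine h.norm.congr (.of_forall fun ξ => ?_)
  have h0 : 0 ≤ (1 + ‖ξ‖ ^ 2) ^ σ := by positivity
  simp only [pairing_apply_apply, ContinuousLinearMap.mul_apply', norm_mul,
    smulLeftCLM_apply_apply (Function.hasTemperateGrowth_one_add_norm_sq_rpow E3 σ), norm_smul,
    Real.norm_of_nonneg h0]
  ring

lemma ofReal_HNorm_sq (σ : ℝ) (f : 𝓢(E3, ℂ)) :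
    ENNReal.ofReal (HNorm σ f ^ 2) = sobolevSq σ f := by
  have h := integrable_rpow_mul_norm_fourier_sq σ f
  rw [fourier_coe] at h
  unfold HNorm sobolevSq besselWeight
  rw [← Real.sqrt_eq_rpow, Real.sq_sqrt (by positivity),
    ofReal_integral_eq_lintegral_ofReal h (.of_forall fun ξ => by positivity)]
  congr with ξ
  rw [← ofReal_norm, ← ENNReal.ofReal_mul (by positivity), ← ENNReal.ofReal_pow (by positivity),
    mul_pow, ← Real.rpow_natCast (_ ^ (σ / 2)), ← Real.rpow_mul (by positivity)]
  congr 3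
  push_cast; ring

lemma sobolevSq_sum_le {ι : Type*} [Fintype ι] (σ : ℝ) (f : ι → 𝓢(E3, ℂ)) :
    sobolevSq σ (∑ i, f i : 𝓢(E3, ℂ)) ≤ Fintype.card ι * ∑ i, sobolevSq σ (f i) := by
  have m := measurable_besselWeight σ
  have hm (i : ι) : Measurable (𝓕 (f i : E3 → ℂ)) := by
    rw [← fourier_coe]; exact (𝓕 (f i)).continuous.measurable
  have hsum : 𝓕 (∑ i, f i : 𝓢(E3, ℂ)) = ∑ i, 𝓕 (f i) :=
    map_sum (FourierTransform.fourierCLM ℂ 𝓢(E3, ℂ)) f _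
  unfold sobolevSq
  rw [← lintegral_finsetSum _ (by fun_prop), ← lintegral_const_mul _ (by fun_prop)]
  refine lintegral_mono fun ξ => ?_
  refine le_trans ?_ (ENNReal.sq_sum_le_card_mul_sum_sq _)
  rw [← Finset.mul_sum, ← fourier_coe, hsum]
  gcongr
  simp only [sum_apply, ← fourier_coe]
  exact enorm_sum_le _ _

/-- The partial derivative of a complex Schwartz function in the `k`-th coordinate direction. -/
abbrev SchwartzMap.partialD (k : Fin 3) (f : 𝓢(E3, ℂ)) : 𝓢(E3, ℂ) :=
  ∂_{EuclideanSpace.single k (1 : ℝ)} f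

/-- Multiplication by a function whose gradient lies in `H^{s'}` is bounded on `H^s`, in terms of
the weighted Fourier transform of the multiplier. -/
lemma exists_sobolevSq_mul_le {s s' : ℝ} (hs : 3 / 2 < s) (hs' : s - 1 ≤ s') :
    ∃ K : ENNReal, K ≠ ⊤ ∧ ∀ f g : 𝓢(E3, ℂ),
      sobolevSq s (pairing (ContinuousLinearMap.mul ℂ ℂ) f g) ≤
        K * (∑ k : Fin 3, sobolevSq s' (partialD k f)) *
          sobolevSq s g := by
  obtain ⟨K, hK, h⟩ := exists_lintegral_besselWeight_conv_le hs hs'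
  refine ⟨K, hK, fun f g => ?_⟩
  have hm (f : 𝓢(E3, ℂ)) : Measurable (𝓕 f : 𝓢(E3, ℂ)) := (𝓕 f).continuous.measurable
  have m := measurable_besselWeight
  calc sobolevSq s (pairing (ContinuousLinearMap.mul ℂ ℂ) f g)
      ≤ ∫⁻ ξ, (besselWeight s ξ * ∫⁻ t, ‖𝓕 f t‖ₑ * ‖𝓕 g (ξ - t)‖ₑ) ^ 2 := by
        unfold sobolevSq
        gcongr with ξ
        exact enorm_fourier_pairing_mul_le f g ξ
    _ ≤ K * (∫⁻ t, (‖t‖ₑ * besselWeight s' t * ‖𝓕 f t‖ₑ) ^ 2) *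
          ∫⁻ t, (besselWeight s t * ‖𝓕 g t‖ₑ) ^ 2 :=
        h _ _ (hm f).enorm (hm g).enorm
    _ ≤ _ := by
        gcongr
        · simp only [sobolevSq]
          rw [← lintegral_finsetSum _ (fun k _ => by
            have := m s'
            have := hm (partialD k f)
            rw [← fourier_coe]
            fun_prop)]
          refine lintegral_mono fun t => ?_
          have hk (k : Fin 3) : ‖𝓕 (partialD k f) t‖ₑ =
              ENNReal.ofReal (2 * π) * ‖t k‖ₑ * ‖𝓕 f t‖ₑ := by
            rw [fourier_lineDerivOp_eq, smul_apply, smulLeftCLM_apply_apply (by fun_prop),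
              enorm_smul, enorm_smul, ← mul_assoc]
            congr 2
            · rw [← ofReal_norm]; simp [abs_of_pos Real.pi_pos]
            · simp [EuclideanSpace.inner_single_right]
          have ht : ‖t‖ₑ ^ 2 = ∑ k, ‖t k‖ₑ ^ 2 := by
            simp only [← ofReal_norm, ← ENNReal.ofReal_pow (norm_nonneg _)]
            rw [EuclideanSpace.norm_sq_eq, ENNReal.ofReal_sum_of_nonneg (fun _ _ => by positivity)]
          simp only [← fourier_coe, hk]
          calc (‖t‖ₑ * besselWeight s' t * ‖𝓕 f t‖ₑ) ^ 2
              = 1 * (∑ k, ‖t k‖ₑ ^ 2) * (besselWeight s' t * ‖𝓕 f t‖ₑ) ^ 2 := by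
                rw [← ht]; ring
            _ ≤ ENNReal.ofReal (2 * π) ^ 2 * (∑ k, ‖t k‖ₑ ^ 2) *
                  (besselWeight s' t * ‖𝓕 f t‖ₑ) ^ 2 := by
                gcongr
                refine one_le_pow₀ ?_
                rw [ENNReal.one_le_ofReal]
                linarith [Real.pi_gt_three]
            _ = _ := by
                rw [Finset.mul_sum, Finset.sum_mul]
                exact Finset.sum_congr rfl fun k _ => by ring
        · exact le_rfl

/-- The complexification of a real Schwartz function. -/
def SchwartzMap.toComplex (f : 𝓢(E3, ℝ)) : 𝓢(E3, ℂ) := f.postcompCLM Complex.ofRealCLM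

lemma pdR_toComplex (k : Fin 3) (f : 𝓢(E3, ℝ)) :
    (fun x => (pdR k f x : ℂ)) = partialD k f.toComplex := by
  ext x
  rw [lineDerivOp_apply_eq_fderiv]
  have h : HasFDerivAt (f.toComplex) (Complex.ofRealCLM.comp (fderiv ℝ f x)) x :=
    Complex.ofRealCLM.hasFDerivAt.comp x (f.hasFDerivAt x)
  rw [h.fderiv]
  rfl

lemma ofReal_GradVNorm_sq (σ : ℝ) (u : Fin 3 → 𝓢(E3, ℝ)) :
    ENNReal.ofReal (GradVNorm σ (toVF u) ^ 2) =
      ∑ i, ∑ k, sobolevSq σ (partialD k (u i).toComplex) := by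
  unfold GradVNorm HNormR toVF
  rw [← Real.sqrt_eq_rpow, Real.sq_sqrt (by positivity),
    ENNReal.ofReal_sum_of_nonneg (fun _ _ => Finset.sum_nonneg fun _ _ => sq_nonneg _)]
  refine Finset.sum_congr rfl fun i _ => ?_
  rw [ENNReal.ofReal_sum_of_nonneg (fun _ _ => by positivity)]
  refine Finset.sum_congr rfl fun k _ => ?_
  rw [pdR_toComplex, ofReal_HNorm_sq]

lemma adv_toComplex (u v : Fin 3 → 𝓢(E3, ℝ)) (i : Fin 3) :
    (fun x => (adv (toVF u) (toVF v) i x : ℂ)) =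
      (∑ k, pairing (ContinuousLinearMap.mul ℂ ℂ) (u k).toComplex
        (partialD k (v i).toComplex) : 𝓢(E3, ℂ)) := by
  ext x
  simp only [adv, toVF, Complex.ofReal_sum, Complex.ofReal_mul, sum_apply, pairing_apply_apply,
    ← pdR_toComplex]
  rfl

lemma ofReal_VNorm_adv_sq (σ : ℝ) (u v : Fin 3 → 𝓢(E3, ℝ)) :
    ENNReal.ofReal (VNorm σ (adv (toVF u) (toVF v)) ^ 2) =
      ∑ i, sobolevSq σ (∑ k, pairing (ContinuousLinearMap.mul ℂ ℂ) (u k).toComplex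
        (partialD k (v i).toComplex) : 𝓢(E3, ℂ)) := by
  unfold VNorm HNormR
  rw [← Real.sqrt_eq_rpow, Real.sq_sqrt (by positivity),
    ENNReal.ofReal_sum_of_nonneg (fun _ _ => by positivity)]
  exact Finset.sum_congr rfl fun i _ => by rw [adv_toComplex, ofReal_HNorm_sq]

/-- Lemma 2.7: `∥(u·∇)j∥_{H^s} ≤ C ∥∇u∥_{H^{s'}} ∥∇j∥_{H^s}`
for `s > 3/2`, `s−1 ≤ s' ≤ s+1` and Schwartz vector fields `u, j`. -/
theorem advection_estimate_uj (s s' : ℝ) (hs : 3 / 2 < s)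
    (hs'1 : s - 1 ≤ s') (hs'2 : s' ≤ s + 1) :
    ∃ C : ℝ, 0 < C ∧ ∀ u j : Fin 3 → SchwartzMap E3 ℝ,
      VNorm s (adv (toVF u) (toVF j)) ≤
        C * GradVNorm s' (toVF u) * GradVNorm s (toVF j) := by
  obtain ⟨K, hK, h⟩ := exists_sobolevSq_mul_le hs hs'1
  refine ⟨√(3 * K.toReal) + 1, by positivity, fun u v => ?_⟩
  have hG (σ : ℝ) (u : Fin 3 → 𝓢(E3, ℝ)) : 0 ≤ GradVNorm σ (toVF u) := by
    unfold GradVNorm; positivity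
  set D : 𝓢(E3, ℝ) → Fin 3 → 𝓢(E3, ℂ) :=
    fun f k => partialD k f.toComplex
  have key : ENNReal.ofReal (VNorm s (adv (toVF u) (toVF v)) ^ 2) ≤
      3 * K * ENNReal.ofReal (GradVNorm s' (toVF u) ^ 2) *
        ENNReal.ofReal (GradVNorm s (toVF v) ^ 2) := by
    rw [ofReal_VNorm_adv_sq, ofReal_GradVNorm_sq, ofReal_GradVNorm_sq, Finset.mul_sum]
    refine Finset.sum_le_sum fun i _ => ?_
    calc _ ≤ 3 * ∑ k, sobolevSq s (pairing (ContinuousLinearMap.mul ℂ ℂ) (u k).toComplex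
            (D (v i) k)) := by
          simpa using sobolevSq_sum_le s fun k =>
            pairing (ContinuousLinearMap.mul ℂ ℂ) (u k).toComplex (D (v i) k)
      _ ≤ 3 * ∑ k, K * (∑ i, ∑ l, sobolevSq s' (D (u i) l)) * sobolevSq s (D (v i) k) := by
          gcongr with k
          refine (h _ _).trans ?_
          gcongr K * ?_ * _
          exact Finset.single_le_sum (f := fun i => ∑ l, sobolevSq s' (D (u i) l))
            (fun _ _ => zero_le) (Finset.mem_univ k)
      _ = _ := by rw [← Finset.mul_sum]; ring
  rw [← ENNReal.ofReal_toReal hK, show (3 : ENNReal) = ENNReal.ofReal 3 by simp,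
    ← ENNReal.ofReal_mul (by positivity), ← ENNReal.ofReal_mul (by positivity),
    ← ENNReal.ofReal_mul (by positivity), ENNReal.ofReal_le_ofReal_iff (by positivity)] at key
  have hu := hG s' u
  have hv := hG s v
  refine le_of_sq_le_sq (key.trans ?_) (by positivity)
  rw [mul_pow, mul_pow]
  gcongr
  calc 3 * K.toReal = √(3 * K.toReal) ^ 2 := (Real.sq_sqrt (by positivity)).symm
    _ ≤ _ := by gcongr; linarith

end
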